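/- Let n ≥ 1 and let f : ℝⁿ → ℝⁿ be a local homeomorphism (every point has an open neighborhood on which f restricts to a homeomorphism onto an open set) which is of class C¹. Then the Jacobian det(df_p) does not change sign: at all points p where det(df_p) ≠ 0, the sign of det(df_p) is the same. -/

import Mathlib

open MeasureTheory Set Metric Topology
open scoped Pointwise

set_option linter.unusedSectionVars false

namespace JacSign

lemma exists_plateau (δ : ℝ) (hδ : 0 < δ) : ∃ α b : ℝ → ℝ, ContDiff ℝ 1 α ∧
    (∀ t, HasDerivAt α (b t - b (t - 1)) t) ∧ (∀ t, 0 ≤ b t) ∧ 0 < b 0 ∧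
    (∀ t, δ ≤ |t| → b t = 0) ∧ (∀ t, α t ≠ 0 → -δ < t ∧ t < 1 + δ) := by
  let b : ℝ → ℝ := fun s => max 0 (δ - |s|)
  have hb : Continuous b := by fun_prop
  have hb0 : ∀ t, δ ≤ |t| → b t = 0 := fun t ht => max_eq_left (by linarith)
  let B : ℝ → ℝ := fun t => ∫ s in (0 : ℝ)..t, b s
  have hB : ∀ t, HasDerivAt B (b t) t := fun t =>
    intervalIntegral.integral_hasDerivAt_right (hb.intervalIntegrable _ _)
      (hb.stronglyMeasurableAtFilter _ _) hb.continuousAt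
  let α : ℝ → ℝ := fun t => B t - B (t - 1)
  have hα : ∀ t, HasDerivAt α (b t - b (t - 1)) t := fun t =>
    (hB t).sub ((hB (t - 1)).comp_sub_const t 1)
  have hα' : ∀ t, α t = ∫ s in (t - 1)..t, b s := fun t => by
    rw [← intervalIntegral.integral_interval_sub_left (hb.intervalIntegrable 0 t)
      (hb.intervalIntegrable 0 (t - 1))]
  refine ⟨α, b, ?_, hα, fun t => le_max_left _ _, ?_, hb0, ?_⟩
  · rw [contDiff_one_iff_deriv]
    refine ⟨fun t => (hα t).differentiableAt, ?_⟩
    have : deriv α = fun t => b t - b (t - 1) := funext fun t => (hα t).deriv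
    rw [this]; fun_prop
  · simp [b, hδ]
  · intro t ht
    by_contra hcon
    apply ht
    rw [hα', intervalIntegral.integral_congr (g := fun _ => (0 : ℝ)), intervalIntegral.integral_zero]
    intro s hs
    rw [uIcc_of_le (by linarith)] at hs
    apply hb0
    rw [not_and_or, not_lt, not_lt] at hcon
    rcases hcon with h | h
    · exact le_abs.2 (Or.inr (by linarith [hs.2]))
    · exact le_abs.2 (Or.inl (by linarith [hs.1]))

variable {E : Type*} [NormedAddCommGroup E] [InnerProductSpace ℝ E] [FiniteDimensional ℝ E]

lemma exists_test_map (a b c : E) (hab : a ≠ b) (r : ℝ) (ha : a ∈ ball c r) (hb : b ∈ ball c r)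
    (η : ℝ) (hη : 0 < η) : ∃ g : E → E, ContDiff ℝ 1 g ∧ tsupport g ⊆ closedBall c (2 * r) ∧
      (∀ y, (fderiv ℝ g y).det ≠ 0 → (dist y a < η ∧ 0 < (fderiv ℝ g y).det) ∨
        (dist y b < η ∧ (fderiv ℝ g y).det < 0)) ∧ 0 < (fderiv ℝ g a).det := by
  have hr : 0 < r := dist_nonneg.trans_lt (mem_ball.1 ha)
  set v := b - a with hv
  have hv0 : v ≠ 0 := sub_ne_zero.2 hab.symm
  have hvn : 0 < ‖v‖ := norm_pos_iff.2 hv0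
  let l : E →L[ℝ] ℝ := (‖v‖ ^ 2)⁻¹ • innerSL ℝ v
  have hlv : l v = 1 := by
    simp only [l, smul_apply, innerSL_apply_apply, real_inner_self_eq_norm_sq,
      smul_eq_mul]
    exact inv_mul_cancel₀ (by positivity)
  set m := max (dist a c) (dist b c) with hm
  have hmr : m < r := max_lt ha hb
  obtain ⟨δ, hδ, hδ2, hδη, hδm⟩ : ∃ δ : ℝ, 0 < δ ∧ δ ≤ 1 / 2 ∧ δ * (‖v‖ + 1) < η ∧
      m + δ * (‖v‖ + 1) < r := by
    have hpos : 0 < min η (r - m) := lt_min hη (by linarith)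
    refine ⟨min (1 / 2) (min η (r - m) / (2 * (‖v‖ + 1))), by positivity, min_le_left _ _, ?_⟩
    have h1 : min (1 / 2) (min η (r - m) / (2 * (‖v‖ + 1))) * (‖v‖ + 1) ≤ min η (r - m) / 2 := by
      calc _ ≤ (min η (r - m) / (2 * (‖v‖ + 1))) * (‖v‖ + 1) := by gcongr; exact min_le_right _ _
        _ = _ := by field_simp
    have h2 := min_le_left η (r - m)
    have h3 := min_le_right η (r - m)
    constructor <;> linarith
  obtain ⟨α, w, hαc, hαd, hw, hw0, hwδ, hαs⟩ := exists_plateau δ hδ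
  let β : ContDiffBump (0 : E) := ⟨δ / 2, δ, by positivity, by linarith⟩
  have hβs : ∀ z, β z ≠ 0 → ‖z‖ < δ := fun z hz => by
    have : z ∈ Function.support β := hz
    rw [β.support_eq] at this
    simpa using this
  let χ : ContDiffBump c := ⟨r, 2 * r, hr, by linarith⟩
  let P : E →L[ℝ] E := ContinuousLinearMap.id ℝ E - l.smulRight v
  have hPv : P v = 0 := by simp [P, hlv]
  have hlP : ∀ z, l (P z) = 0 := fun z => by simp [P, hlv]
  let h : E → ℝ := fun y => α (l (y - a)) * β (P (y - a))
  have hhc : ContDiff ℝ 1 h := by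
    refine (hαc.comp (l.contDiff.comp (contDiff_id.sub contDiff_const))).mul ?_
    exact β.contDiff.comp (P.contDiff.comp (contDiff_id.sub contDiff_const))
  have hhd : ∀ y, fderiv ℝ h y v = (w (l (y - a)) - w (l (y - a) - 1)) * β (P (y - a)) := by
    intro y
    have h1 : HasFDerivAt (fun y => l (y - a)) l y := l.hasFDerivAt.comp y (hasFDerivAt_sub_const a)
    have h2 : HasFDerivAt (fun y => P (y - a)) P y := P.hasFDerivAt.comp y (hasFDerivAt_sub_const a)
    have h3 := (hαd (l (y - a))).comp_hasFDerivAt y h1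
    have h4 := ((β.contDiff (n := 1)).differentiable one_ne_zero
      (P (y - a))).hasFDerivAt.comp y h2
    have h5 := (h3.mul h4).fderiv
    have h6 : fderiv ℝ h y = _ := h5
    rw [h6]
    simp [hPv, hlv, mul_comm]
  have hdecomp : ∀ y, y - a = l (y - a) • v + P (y - a) := fun y => by simp [P]
  have hhs : ∀ y, h y ≠ 0 → dist y c ≤ m + δ * (‖v‖ + 1) := by
    intro y hy
    obtain ⟨h1, h2⟩ := hαs _ (left_ne_zero_of_mul hy)
    have h3 := hβs _ (right_ne_zero_of_mul hy)
    set t := l (y - a)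
    obtain ⟨t', ht0, ht1, htt⟩ : ∃ t' : ℝ, 0 ≤ t' ∧ t' ≤ 1 ∧ |t - t'| ≤ δ := by
      refine ⟨max 0 (min 1 t), le_max_left _ _, max_le zero_le_one (min_le_left _ _), ?_⟩
      rw [abs_le]
      rcases le_total 1 t with h4 | h4
      · rw [min_eq_left h4, max_eq_right zero_le_one]; constructor <;> linarith
      · rw [min_eq_right h4]
        rcases le_total 0 t with h5 | h5
        · rw [max_eq_right h5]; constructor <;> linarith
        · rw [max_eq_left h5]; constructor <;> linarith
    have e1 : y - c = ((1 - t') • (a - c) + t' • (b - c)) + ((t - t') • v + P (y - a)) := by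
      have hy1 : y - a = t • v + P (y - a) := hdecomp y
      have e2 : y - c = (y - a) + (a - c) := by abel
      rw [e2]
      generalize P (y - a) = z at hy1 ⊢
      rw [hy1, hv]
      module
    rw [dist_eq_norm, e1]
    have n1 : ‖(1 - t') • (a - c) + t' • (b - c)‖ ≤ m := by
      refine (norm_add_le _ _).trans ?_
      rw [norm_smul, norm_smul, Real.norm_of_nonneg ht0, Real.norm_of_nonneg (by linarith),
        ← dist_eq_norm, ← dist_eq_norm]
      have := le_max_left (dist a c) (dist b c)
      have := le_max_right (dist a c) (dist b c)
      nlinarith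
    have n2 : ‖(t - t') • v + P (y - a)‖ ≤ δ * (‖v‖ + 1) := by
      refine (norm_add_le _ _).trans ?_
      rw [norm_smul, Real.norm_eq_abs]
      nlinarith
    exact (norm_add_le _ _).trans (add_le_add n1 n2)
  let g : E → E := fun y => χ y • P (y - a) + h y • v
  have hgc : ContDiff ℝ 1 g := by
    refine (χ.contDiff.smul (P.contDiff.comp (contDiff_id.sub contDiff_const))).add ?_
    exact hhc.smul contDiff_const
  have hin : ∀ y ∈ ball c r, (fderiv ℝ g y).det = fderiv ℝ h y v := by
    intro y hy
    have e : g =ᶠ[𝓝 y] fun y => P (y - a) + h y • v := by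
      filter_upwards [isOpen_ball.mem_nhds hy] with z hz
      simp only [g]
      rw [χ.one_of_mem_closedBall (ball_subset_closedBall hz), one_smul]
    have h2 : HasFDerivAt (fun y => P (y - a)) P y := P.hasFDerivAt.comp y (hasFDerivAt_sub_const a)
    have h3 : HasFDerivAt (fun y => h y • v) ((fderiv ℝ h y).smulRight v) y :=
      (hhc.differentiable one_ne_zero y).hasFDerivAt.smul_const v
    have h4 : fderiv ℝ (fun y => P (y - a) + h y • v) y = P + (fderiv ℝ h y).smulRight v :=
      (h2.add h3).fderiv
    rw [e.fderiv_eq, h4]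
    have e3 : ((P + (fderiv ℝ h y).smulRight v : E →L[ℝ] E) : E →ₗ[ℝ] E) =
        LinearMap.transvection ((fderiv ℝ h y - l : E →L[ℝ] ℝ) : E →ₗ[ℝ] ℝ) v := by
      ext z
      simp [P, LinearMap.transvection.apply, sub_smul]
      abel
    rw [ContinuousLinearMap.det, e3, LinearMap.transvection.det]
    simp [hlv]
  have hout : ∀ y, y ∉ ball c r → (fderiv ℝ g y).det = 0 := by
    intro y hy
    have hy' : r ≤ dist y c := by simpa using hy
    have e : ∀ᶠ z in 𝓝 y, h z = 0 := by
      have : ∀ᶠ z in 𝓝 y, m + δ * (‖v‖ + 1) < dist z c :=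
        (continuous_id.dist continuous_const).continuousAt.eventually
          (lt_mem_nhds (hδm.trans_le hy'))
      filter_upwards [this] with z hz
      by_contra hne
      exact absurd (hhs z hne) (not_le.2 hz)
    have e2 : (fun z => l (g z)) =ᶠ[𝓝 y] fun _ => 0 := by
      filter_upwards [e] with z hz
      simp [g, hz, hlP]
    have h1 : HasFDerivAt (fun z => l (g z)) (l.comp (fderiv ℝ g y)) y :=
      l.hasFDerivAt.comp y (hgc.differentiable one_ne_zero y).hasFDerivAt
    have h2 : l.comp (fderiv ℝ g y) = 0 := by
      rw [← h1.fderiv, e2.fderiv_eq]; simp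
    by_contra hdet
    obtain ⟨z, hz⟩ := (LinearMap.equivOfDetNeZero (fderiv ℝ g y : E →ₗ[ℝ] E) hdet).surjective v
    have hz' : fderiv ℝ g y z = v := hz
    have := congrArg (fun T : E →L[ℝ] ℝ => T z) h2
    simp [hz', hlv] at this
  refine ⟨g, hgc, ?_, ?_, ?_⟩
  · apply closure_minimal _ isClosed_closedBall
    intro y hy
    by_contra hyc
    apply hy
    have hyc' : 2 * r < dist y c := by simpa using hyc
    have h1 : χ y = 0 := χ.zero_of_le_dist hyc'.le
    have h2 : h y = 0 := by
      by_contra hne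
      have := hhs y hne
      linarith
    simp [g, h1, h2]
  · intro y hy
    by_cases hyb : y ∈ ball c r
    swap
    · exact absurd (hout y hyb) hy
    rw [hin y hyb, hhd] at hy ⊢
    have hβ := right_ne_zero_of_mul hy
    have hw' := left_ne_zero_of_mul hy
    have hn := hβs _ hβ
    have hβp : 0 < β (P (y - a)) := lt_of_le_of_ne β.nonneg hβ.symm
    have hd := hdecomp y
    set t := l (y - a)
    by_cases ht : |t| < δ
    · left
      have ht' := abs_lt.1 ht
      have z : w (t - 1) = 0 := hwδ _ (le_abs.2 (Or.inr (by linarith)))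
      rw [z, sub_zero] at hw' ⊢
      refine ⟨?_, mul_pos (lt_of_le_of_ne (hw t) hw'.symm) hβp⟩
      rw [dist_eq_norm, hd]
      refine (norm_add_le _ _).trans_lt ?_
      rw [norm_smul, Real.norm_eq_abs]
      nlinarith
    · right
      have z : w t = 0 := hwδ _ (not_lt.1 ht)
      rw [z, zero_sub] at hw' ⊢
      have hw'' := neg_ne_zero.1 hw'
      have ht1 : |t - 1| < δ := by
        by_contra hcon
        exact hw'' (hwδ _ (not_lt.1 hcon))
      have : 0 < w (t - 1) := lt_of_le_of_ne (hw _) hw''.symm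
      refine ⟨?_, by nlinarith⟩
      have e1 : y - b = (t - 1) • v + P (y - a) := by
        have : y - b = (y - a) - v := by rw [hv]; abel
        rw [this]
        generalize P (y - a) = z at hd ⊢
        rw [hd]; module
      rw [dist_eq_norm, e1]
      refine (norm_add_le _ _).trans_lt ?_
      rw [norm_smul, Real.norm_eq_abs]
      nlinarith
  · rw [hin a ha, hhd]
    have z : w (0 - 1) = 0 := hwδ _ (by norm_num; linarith)
    have hb0 : 0 < β (0 : E) := by
      rw [β.one_of_mem_closedBall (by simp; positivity)]; exact one_pos
    simp only [sub_self, map_zero, z, sub_zero]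
    exact mul_pos hw0 hb0

end JacSign


namespace JacSign

variable {E : Type*} [NormedAddCommGroup E] [InnerProductSpace ℝ E] [FiniteDimensional ℝ E]
  [MeasurableSpace E] [BorelSpace E]

lemma det_pos_of_large (C : ℝ) : ∃ S : ℝ, 0 < S ∧ ∀ s > S, ∀ A : E →L[ℝ] E, ‖A‖ ≤ C →
    0 < (s • ContinuousLinearMap.id ℝ E - A).det := by
  have h1 : ∀ᶠ B : E →L[ℝ] E in 𝓝 (ContinuousLinearMap.id ℝ E), 0 < B.det := by
    have := (ContinuousLinearMap.continuous_det (𝕜 := ℝ) (E := E)).continuousAt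
      (x := ContinuousLinearMap.id ℝ E)
    refine this.eventually (lt_mem_nhds ?_)
    simp [ContinuousLinearMap.det]
  obtain ⟨δ, hδ, h⟩ := Metric.eventually_nhds_iff.1 h1
  refine ⟨(|C| + 1) / δ, by positivity, fun s hs A hA => ?_⟩
  have hs0 : 0 < s := lt_trans (by positivity) hs
  have e : s • ContinuousLinearMap.id ℝ E - A
      = s • (ContinuousLinearMap.id ℝ E - s⁻¹ • A) := by
    rw [smul_sub, smul_smul, mul_inv_cancel₀ hs0.ne', one_smul]
  have h2 : 0 < (ContinuousLinearMap.id ℝ E - s⁻¹ • A).det := by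
    apply h
    rw [dist_eq_norm]
    have : ContinuousLinearMap.id ℝ E - s⁻¹ • A - ContinuousLinearMap.id ℝ E = -(s⁻¹ • A) := by abel
    rw [this, norm_neg, norm_smul, norm_inv, Real.norm_of_nonneg hs0.le]
    rw [gt_iff_lt, div_lt_iff₀ hδ] at hs
    rw [inv_mul_lt_iff₀ hs0]
    have := le_abs_self C
    linarith
  rw [e]
  have e2 : (s • (ContinuousLinearMap.id ℝ E - s⁻¹ • A)).det
      = s ^ Module.finrank ℝ E * (ContinuousLinearMap.id ℝ E - s⁻¹ • A).det := by
    simp only [ContinuousLinearMap.det, ContinuousLinearMap.toLinearMap_smul, LinearMap.det_smul]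
  rw [e2]; positivity

lemma bij_large (u : E → E) (hu : ContDiff ℝ 1 u) (hc : HasCompactSupport u) :
    ∃ S : ℝ, 0 < S ∧ ∀ s > S, Function.Bijective (fun x => s • x - u x) ∧
      ∀ x, 0 < (s • ContinuousLinearMap.id ℝ E - fderiv ℝ u x).det := by
  obtain ⟨C, hC⟩ := ContDiff.lipschitzWith_of_hasCompactSupport hc hu one_ne_zero
  obtain ⟨S, hS, hdet⟩ := det_pos_of_large (E := E) C
  refine ⟨max S C, lt_max_of_lt_left hS, fun s hs => ⟨?_, fun x => hdet s
    ((le_max_left _ _).trans_lt hs) _ (norm_fderiv_le_of_lipschitz ℝ hC)⟩⟩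
  have hsC : (C : ℝ) < s := (le_max_right _ _).trans_lt hs
  have hs0 : 0 < s := hS.trans ((le_max_left _ _).trans_lt hs)
  constructor
  · intro x y hxy
    simp only at hxy
    have h1 : s • (x - y) = u x - u y := by
      rw [smul_sub, sub_eq_sub_iff_sub_eq_sub]; exact hxy
    have h2 := hC.norm_sub_le x y
    rw [← h1, norm_smul, Real.norm_of_nonneg hs0.le] at h2
    by_contra hne
    have : 0 < ‖x - y‖ := norm_pos_iff.2 (sub_ne_zero.2 hne)
    nlinarith
  · intro y
    have hk : ContractingWith (C / s.toNNReal) (fun x => s⁻¹ • (y + u x)) := by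
      constructor
      · rw [div_lt_one (by simpa using hs0)]
        rw [← NNReal.coe_lt_coe, Real.coe_toNNReal _ hs0.le]; exact hsC
      · apply LipschitzWith.of_dist_le_mul
        intro a b
        rw [dist_eq_norm, ← smul_sub, norm_smul, norm_inv, Real.norm_of_nonneg hs0.le,
          add_sub_add_left_eq_sub, NNReal.coe_div, Real.coe_toNNReal _ hs0.le, dist_eq_norm,
          div_eq_inv_mul, mul_assoc]
        gcongr
        exact hC.norm_sub_le a b
    refine ⟨hk.fixedPoint, ?_⟩
    have := hk.fixedPoint_isFixedPt
    unfold Function.IsFixedPt at this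
    simp only at this ⊢
    set z := hk.fixedPoint
    have h3 : s • z = y + u z := by
      nth_rw 1 [← this]; rw [smul_smul, mul_inv_cancel₀ hs0.ne', one_smul]
    rw [h3]; abel

lemma integral_det_eq_zero [Nontrivial E] (u : E → E) (hu : ContDiff ℝ 1 u)
    (hc : HasCompactSupport u) : ∫ x, (fderiv ℝ u x).det = 0 := by
  obtain ⟨S, hS, hb⟩ := bij_large u hu hc
  set n := Module.finrank ℝ E with hn
  have hn0 : 0 < n := Module.finrank_pos
  set K := tsupport u with hK
  have hKc : IsCompact K := hc
  have hcont : Continuous (fderiv ℝ u) := hu.continuous_fderiv one_ne_zero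
  have key : ∀ s > S, ∫ x in K, (s • ContinuousLinearMap.id ℝ E - fderiv ℝ u x).det
      = s ^ n * volume.real K := by
    intro s hs
    have hs0 : 0 < s := hS.trans hs
    obtain ⟨hbij, hpos⟩ := hb s hs
    have himg : (fun x => s • x - u x) '' K = s • K := by
      have hcompl : (fun x => s • x - u x) '' Kᶜ = (s • K)ᶜ := by
        rw [← Set.image_smul, ← Set.image_compl_eq (MulAction.bijective₀ hs0.ne')]
        apply Set.image_congr
        intro x hx
        rw [image_eq_zero_of_notMem_tsupport hx, sub_zero]
      rw [Set.image_compl_eq hbij] at hcompl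
      exact compl_injective hcompl
    have hder : ∀ x ∈ K, HasFDerivWithinAt (fun x => s • x - u x)
        (s • ContinuousLinearMap.id ℝ E - fderiv ℝ u x) K x := fun x _ =>
      (((hasFDerivAt_id x).const_smul s).sub
        (hu.differentiable one_ne_zero x).hasFDerivAt).hasFDerivWithinAt
    have := integral_image_eq_integral_abs_det_fderiv_smul volume hKc.measurableSet hder
      hbij.1.injOn (fun _ => (1 : ℝ))
    rw [himg] at this
    simp only [smul_eq_mul, mul_one, integral_const, MeasurableSet.univ, measureReal_restrict_apply,
      univ_inter] at this
    rw [Measure.real, Measure.addHaar_smul, ENNReal.toReal_mul, ENNReal.toReal_ofReal (abs_nonneg _),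
      abs_of_pos (by positivity)] at this
    rw [Measure.real, this]
    exact integral_congr_ae (Filter.Eventually.of_forall fun x => (abs_of_pos (hpos x)).symm)
  -- interpolation
  let v : ℕ → ℝ := fun i => S + 1 + i
  let s := Finset.range (n + 1)
  have hv : Set.InjOn v s := by
    intro i _ j _ h; simpa [v] using h
  have interp : ∀ p : Polynomial ℝ, p.degree < s.card → p.eval 0
      = ∑ i ∈ s, p.eval (v i) * (Lagrange.basis s v i).eval 0 := by
    intro p hp
    conv_lhs => rw [Lagrange.eq_interpolate hv hp]
    simp [Lagrange.interpolate_apply, Polynomial.eval_finsetSum]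
  have hchar : ∀ A : E →L[ℝ] E, (-A).det = ∑ i ∈ s,
      (v i • ContinuousLinearMap.id ℝ E - A).det * (Lagrange.basis s v i).eval 0 := by
    intro A
    have hd : (A : E →ₗ[ℝ] E).charpoly.degree < s.card := by
      rw [Polynomial.degree_eq_natDegree (LinearMap.charpoly_monic _).ne_zero,
        LinearMap.charpoly_natDegree]
      simp [s, ← hn]
      exact_mod_cast Nat.lt_succ_self n
    have := interp _ hd
    simp only [LinearMap.eval_charpoly, map_zero, zero_sub] at this
    exact this
  have hint : ∫ x in K, (-fderiv ℝ u x).det = 0 := by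
    simp_rw [hchar]
    rw [integral_finsetSum]
    · simp_rw [integral_mul_const]
      have hp := interp (Polynomial.X ^ n) (by
        rw [Polynomial.degree_X_pow]; simp [s]; exact_mod_cast Nat.lt_succ_self n)
      simp [hn0.ne'] at hp
      rw [Finset.sum_congr rfl (g := fun i => (v i ^ n * (Lagrange.basis s v i).eval 0) *
        volume.real K), ← Finset.sum_mul, ← hp, zero_mul]
      intro i _
      rw [key (v i) (by simp only [v]; linarith [Nat.cast_nonneg (α := ℝ) i])]; ring
    · intro i _
      refine (ContinuousOn.integrableOn_compact hKc ?_)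
      refine Continuous.continuousOn ?_
      exact (ContinuousLinearMap.continuous_det.comp (continuous_const.sub hcont)).mul
        continuous_const
  have hneg : ∀ x, (-fderiv ℝ u x).det = (-1) ^ n * (fderiv ℝ u x).det := by
    intro x
    rw [← neg_one_smul ℝ (fderiv ℝ u x)]
    simp only [ContinuousLinearMap.det, ContinuousLinearMap.toLinearMap_smul, LinearMap.det_smul, hn]
  simp_rw [hneg, integral_const_mul] at hint
  have h0 : ∫ x in K, (fderiv ℝ u x).det = 0 := by
    rcases mul_eq_zero.1 hint with h | h
    · exact absurd h (by simp)
    · exact h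
  rw [← h0]
  symm
  apply setIntegral_eq_integral_of_forall_compl_eq_zero
  intro x hx
  have : fderiv ℝ u x = 0 := by
    by_contra hne
    exact hx (support_fderiv_subset ℝ hne)
  rw [this]
  simp [ContinuousLinearMap.det]

lemma local_sign [Nontrivial E] (f : E → E) (hf : ContDiff ℝ 1 f) (hloc : IsLocalHomeomorph f)
    (x₀ : E) : ∃ V : Set E, IsOpen V ∧ x₀ ∈ V ∧ ∀ p ∈ V, ∀ q ∈ V,
      0 < (fderiv ℝ f p).det → (fderiv ℝ f q).det < 0 → False := by
  obtain ⟨e, hx₀, hef⟩ := hloc x₀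
  have hfe : ∀ x, f x = e x := fun x => congrFun hef x
  have hdf : Continuous (fun x => (fderiv ℝ f x).det) :=
    ContinuousLinearMap.continuous_det.comp (hf.continuous_fderiv one_ne_zero)
  have hft : f x₀ ∈ e.target := by rw [hfe]; exact e.map_source hx₀
  obtain ⟨ε, hε, hball⟩ := Metric.isOpen_iff.1 e.open_target _ hft
  set r := ε / 4 with hr
  have hr0 : 0 < r := by positivity
  have hcb : closedBall (f x₀) (2 * r) ⊆ e.target :=
    (closedBall_subset_ball (by linarith)).trans hball
  refine ⟨e.source ∩ f ⁻¹' ball (f x₀) r, e.open_source.inter (isOpen_ball.preimage hf.continuous),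
    ⟨hx₀, mem_ball_self hr0⟩, ?_⟩
  rintro p ⟨hps, hpb⟩ q ⟨hqs, hqb⟩ hp hq
  have hpq : f p ≠ f q := by
    intro h
    rw [hfe, hfe] at h
    have := e.injOn hps hqs h
    rw [this] at hp
    linarith
  have near : ∀ x ∈ e.source, ∀ U : Set E, IsOpen U → x ∈ U →
      ∃ η > 0, ∀ z ∈ e.source, dist (f z) (f x) < η → z ∈ U := by
    intro x hx U hU hxU
    have h1 : ContinuousAt e.symm (f x) := by
      rw [hfe]; exact e.continuousAt_symm (e.map_source hx)
    have h2 : e.symm (f x) ∈ U := by rw [hfe, e.left_inv hx]; exact hxU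
    obtain ⟨η, hη, h⟩ := Metric.eventually_nhds_iff.1 (h1.eventually (hU.mem_nhds h2))
    refine ⟨η, hη, fun z hz hd => ?_⟩
    have := h hd
    rwa [hfe, e.left_inv hz] at this
  obtain ⟨η₁, hη₁, h₁⟩ := near p hps {x | 0 < (fderiv ℝ f x).det}
    (isOpen_lt continuous_const hdf) hp
  obtain ⟨η₂, hη₂, h₂⟩ := near q hqs {x | (fderiv ℝ f x).det < 0}
    (isOpen_lt hdf continuous_const) hq
  obtain ⟨g, hg, hgs, hgd, hgp⟩ := exists_test_map (f p) (f q) (f x₀) hpq r hpb hqb (min η₁ η₂)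
    (lt_min hη₁ hη₂)
  classical
  let u : E → E := e.source.indicator (fun x => g (f x))
  have hTc : IsCompact (tsupport g) :=
    (isCompact_closedBall (f x₀) (2 * r)).of_isClosed_subset (isClosed_tsupport g) hgs
  let K := e.symm '' tsupport g
  have hK : IsCompact K := hTc.image_of_continuousOn (e.continuousOn_symm.mono (hgs.trans hcb))
  have hu0 : ∀ x, x ∉ K → u x = 0 := by
    intro x hx
    by_cases hxs : x ∈ e.source
    · simp only [u, indicator_of_mem hxs]
      by_contra hne
      refine hx ⟨f x, subset_tsupport _ hne, ?_⟩
      rw [hfe, e.left_inv hxs]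
    · exact indicator_of_notMem hxs _
  have hKs : K ⊆ e.source := by
    rintro _ ⟨y, hy, rfl⟩
    exact e.map_target (hcb (hgs hy))
  have hus : ∀ x ∈ e.source, u =ᶠ[𝓝 x] fun x => g (f x) := by
    intro x hx
    filter_upwards [e.open_source.mem_nhds hx] with z hz
    exact indicator_of_mem hz _
  have hun : ∀ x, x ∉ e.source → u =ᶠ[𝓝 x] fun _ => 0 := by
    intro x hx
    filter_upwards [hK.isClosed.isOpen_compl.mem_nhds (fun h => hx (hKs h))] with z hz
    exact hu0 z hz
  have huc : ContDiff ℝ 1 u := by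
    rw [contDiff_iff_contDiffAt]
    intro x
    by_cases hx : x ∈ e.source
    · exact (hg.comp hf).contDiffAt.congr_of_eventuallyEq (hus x hx)
    · exact contDiffAt_const.congr_of_eventuallyEq (hun x hx)
  have hucs : HasCompactSupport u := HasCompactSupport.intro hK hu0
  have hdet : ∀ x ∈ e.source, (fderiv ℝ u x).det
      = (fderiv ℝ g (f x)).det * (fderiv ℝ f x).det := by
    intro x hx
    rw [(hus x hx).fderiv_eq]
    have : fderiv ℝ (fun x => g (f x)) x = (fderiv ℝ g (f x)).comp (fderiv ℝ f x) :=
      fderiv_comp x (hg.differentiable one_ne_zero _) (hf.differentiable one_ne_zero _)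
    rw [this]
    simp only [ContinuousLinearMap.det, ContinuousLinearMap.toLinearMap_comp, LinearMap.det_comp]
  have hz : (0 : E →L[ℝ] E).det = 0 := by simp [ContinuousLinearMap.det]
  have hnn : ∀ x, 0 ≤ (fderiv ℝ u x).det := by
    intro x
    by_cases hx : x ∈ e.source
    · rw [hdet x hx]
      by_cases h0 : (fderiv ℝ g (f x)).det = 0
      · rw [h0, zero_mul]
      rcases hgd _ h0 with ⟨hd, hs⟩ | ⟨hd, hs⟩
      · exact (mul_pos hs (h₁ x hx (hd.trans_le (min_le_left _ _)))).le
      · exact (mul_pos_of_neg_of_neg hs (h₂ x hx (hd.trans_le (min_le_right _ _)))).le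
    · rw [(hun x hx).fderiv_eq]
      simp [hz]
  have hpos := Continuous.integral_pos_of_hasCompactSupport_nonneg_nonzero (μ := volume)
    (f := fun x => (fderiv ℝ u x).det) (x := p)
    (ContinuousLinearMap.continuous_det.comp (huc.continuous_fderiv one_ne_zero))
    ((hucs.fderiv ℝ).comp_left (g := fun A : E →L[ℝ] E => A.det) hz) hnn
    (by
      show (fderiv ℝ u p).det ≠ 0
      rw [hdet p hps]; exact (mul_pos hgp hp).ne')
  rw [integral_det_eq_zero u huc hucs] at hpos
  exact lt_irrefl _ hpos

lemma dense_regular (f : E → E) (hf : ContDiff ℝ 1 f) (hloc : IsLocalHomeomorph f)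
    (U : Set E) (hU : IsOpen U) (hne : U.Nonempty) : ∃ x ∈ U, (fderiv ℝ f x).det ≠ 0 := by
  by_contra! hcon
  have h0 : volume (f '' U) = 0 := addHaar_image_eq_zero_of_det_fderivWithin_eq_zero volume
    (fun x _ => (hf.differentiable one_ne_zero x).hasFDerivAt.hasFDerivWithinAt) hcon
  exact ((hloc.isOpenMap U hU).measure_pos volume (hne.image f)).ne' h0

lemma global_sign [Nontrivial E] (f : E → E) (hf : ContDiff ℝ 1 f) (hloc : IsLocalHomeomorph f) :
    (∀ p, (fderiv ℝ f p).det ≠ 0 → 0 < (fderiv ℝ f p).det) ∨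
      (∀ p, (fderiv ℝ f p).det ≠ 0 → (fderiv ℝ f p).det < 0) := by
  let A : Set E := {x | ∀ᶠ z in 𝓝 x, 0 ≤ (fderiv ℝ f z).det}
  let B : Set E := {x | ∀ᶠ z in 𝓝 x, (fderiv ℝ f z).det ≤ 0}
  have hA : IsOpen A := isOpen_setOfPred_eventually_nhds
  have hB : IsOpen B := isOpen_setOfPred_eventually_nhds
  have hcov : ∀ x, x ∈ A ∨ x ∈ B := by
    intro x
    obtain ⟨V, hV, hxV, h⟩ := local_sign f hf hloc x
    by_cases hp : ∃ p ∈ V, 0 < (fderiv ℝ f p).det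
    · obtain ⟨p, hpV, hp⟩ := hp
      left
      filter_upwards [hV.mem_nhds hxV] with z hz
      by_contra hn
      exact h p hpV z hz hp (not_le.1 hn)
    · right
      push Not at hp
      filter_upwards [hV.mem_nhds hxV] with z hz using hp z hz
  have hdis : ∀ x, x ∈ A → x ∈ B → False := by
    intro x hxA hxB
    obtain ⟨W, hW, hWo, hxW⟩ := _root_.eventually_nhds_iff.1 (hxA.and hxB)
    obtain ⟨z, hz, hne⟩ := dense_regular f hf hloc W hWo ⟨x, hxW⟩
    exact hne (le_antisymm (hW z hz).2 (hW z hz).1)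
  have hclopen : IsClopen A := by
    refine ⟨?_, hA⟩
    have : A = Bᶜ := by
      ext x
      exact ⟨fun h1 h2 => hdis x h1 h2, fun h => (hcov x).resolve_right h⟩
    rw [this]; exact hB.isClosed_compl
  rcases isClopen_iff.1 hclopen with h | h
  · right
    intro p hp
    have hpB : p ∈ B := (hcov p).resolve_left (by rw [h]; exact notMem_empty p)
    exact lt_of_le_of_ne hpB.self_of_nhds hp
  · left
    intro p hp
    have hpA : p ∈ A := by rw [h]; exact mem_univ p
    exact lt_of_le_of_ne hpA.self_of_nhds hp.symm

end JacSign

/-- The homological step in the proof of Lemma 4 (Hirsch): a `C¹` local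
homeomorphism `f : ℝⁿ → ℝⁿ` has a Jacobian that does not change sign: at
every point where the Jacobian is nonzero it has the same sign. -/
theorem local_homeomorph_jacobian_no_sign_change
    {n : ℕ} (hn : 1 ≤ n)
    (f : EuclideanSpace ℝ (Fin n) → EuclideanSpace ℝ (Fin n))
    (hf : ContDiff ℝ 1 f) (hloc : IsLocalHomeomorph f) :
    (∀ p, (fderiv ℝ f p).det ≠ 0 → 0 < (fderiv ℝ f p).det) ∨
      (∀ p, (fderiv ℝ f p).det ≠ 0 → (fderiv ℝ f p).det < 0) := by
  have : Nontrivial (EuclideanSpace ℝ (Fin n)) := by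
    apply Module.nontrivial_of_finrank_pos (R := ℝ)
    rw [finrank_euclideanSpace_fin]; exact hn
  exact JacSign.global_sign f hf hloc
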